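/- Let A be a complete NBW over Σ that is limit deterministic with partition (Q_N, Q_D), fix a linear order ≼ on Q in which every element of Q_D precedes every element of Q_N, let w be an ω-word, and let Ĝ be the LDBW run DAG of A over w. Then w ∉ L(A) if and only if Ĝ has a stable level, i.e., there exists s ≥ 1 such that every F-vertex of Ĝ at a level ≥ s is finite. -/

import Mathlib

open scoped Classical

/-- A nondeterministic Büchi automaton on ω-words with states `Q` over alphabet `σ`. -/
structure NBW (σ : Type) (Q : Type) where
  init : Set Q
  trans : Q → σ → Set Q
  acc : Set Q

namespace NBW

variable {σ Q : Type}

/-- `ρ` is a run of `A` on the ω-word `w`. -/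
def IsRun (A : NBW σ Q) (w : ℕ → σ) (ρ : ℕ → Q) : Prop :=
  ρ 0 ∈ A.init ∧ ∀ i, ρ (i + 1) ∈ A.trans (ρ i) (w i)

/-- `ρ` is an accepting run of `A` on `w`: it visits `A.acc` infinitely often. -/
def IsAccRun (A : NBW σ Q) (w : ℕ → σ) (ρ : ℕ → Q) : Prop :=
  A.IsRun w ρ ∧ ∀ n, ∃ m, n ≤ m ∧ ρ m ∈ A.acc

/-- The ω-language accepted by `A`. -/
def Lang (A : NBW σ Q) : Set (ℕ → σ) := {w | ∃ ρ, A.IsAccRun w ρ}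

/-- `A` is complete: every state has a successor on every letter. -/
def Complete (A : NBW σ Q) : Prop := ∀ q a, (A.trans q a).Nonempty

/-- `A` is finitely ambiguous: every accepted word has finitely many accepting runs. -/
def FinitelyAmbiguous (A : NBW σ Q) : Prop :=
  ∀ w ∈ A.Lang, {ρ | A.IsAccRun w ρ}.Finite

/-- `A` is limit deterministic with partition `(QN, QD)`. -/
def LimitDetPart (A : NBW σ Q) (QN QD : Set Q) : Prop :=
  Disjoint QN QD ∧ QN ∪ QD = Set.univ ∧ A.acc ⊆ QD ∧
    ∀ q ∈ QD, ∀ a, ∃ q' ∈ QD, A.trans q a = {q'}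

/-- `A` is limit deterministic (for some partition). -/
def LimitDet (A : NBW σ Q) : Prop := ∃ QN QD, A.LimitDetPart QN QD

end NBW

namespace NBW

variable {σ Q : Type}

/-- `S_ℓ`: the nondeterministic states reached at level `ℓ`. -/
def ldS (A : NBW σ Q) (QN : Set Q) (w : ℕ → σ) : ℕ → Set Q
  | 0 => A.init ∩ QN
  | ℓ + 1 => (⋃ q ∈ ldS A QN w ℓ, A.trans q (w ℓ)) ∩ QN

/-- `P_ℓ`: the deterministic states present at level `ℓ`. -/
def ldP (A : NBW σ Q) (QN QD : Set Q) (dD : Q → σ → Q) (w : ℕ → σ) : ℕ → Set Q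
  | 0 => A.init ∩ QD
  | ℓ + 1 =>
    ((fun q => dD q (w ℓ)) '' ldP A QN QD dD w ℓ) ∪
      (((⋃ q ∈ ldS A QN w ℓ, A.trans q (w ℓ)) ∩ QD) \
        ((fun q => dD q (w ℓ)) '' ldP A QN QD dD w ℓ))

/-- `D_{ℓ+1}`: the `δ_D`-successors of `P_ℓ`. -/
def ldD (A : NBW σ Q) (QN QD : Set Q) (dD : Q → σ → Q) (w : ℕ → σ) (ℓ : ℕ) : Set Q :=
  (fun q => dD q (w ℓ)) '' ldP A QN QD dD w ℓ

/-- `J_{ℓ+1}`: the deterministic states freshly reached by a jump from `S_ℓ`. -/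
def ldJ (A : NBW σ Q) (QN QD : Set Q) (dD : Q → σ → Q) (w : ℕ → σ) (ℓ : ℕ) : Set Q :=
  ((⋃ q ∈ ldS A QN w ℓ, A.trans q (w ℓ)) ∩ QD) \ ldD A QN QD dD w ℓ

/-- Priorities at level `ℓ`: the first component gives the priority of a
deterministic vertex `⟨q, ℓ⟩` and the second component the priority of the
nondeterministic vertex `⟨S_ℓ, ℓ⟩`. -/
noncomputable def ldPr (A : NBW σ Q) [LinearOrder Q] (QN QD : Set Q) (dD : Q → σ → Q)
    (w : ℕ → σ) : ℕ → (Q → ℕ) × ℕ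
  | 0 =>
    (fun q => {q' ∈ A.init ∩ QD | q' ≤ q}.ncard, (A.init ∩ QD).ncard + 1)
  | ℓ + 1 =>
    (fun q =>
      if q ∈ ldD A QN QD dD w ℓ then
        sInf ((ldPr A QN QD dD w ℓ).1 '' {q' ∈ ldP A QN QD dD w ℓ | dD q' (w ℓ) = q})
      else (ldPr A QN QD dD w ℓ).2 + {j ∈ ldJ A QN QD dD w ℓ | j ≤ q}.ncard - 1,
     (ldPr A QN QD dD w ℓ).2 + (ldJ A QN QD dD w ℓ).ncard)

/-- The vertices of the LDBW run DAG `Ĝ` at level `ℓ`: `some q` is the deterministic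
vertex `⟨q, ℓ⟩`, `none` is the nondeterministic vertex `⟨S_ℓ, ℓ⟩`. -/
def ldVtx (A : NBW σ Q) (QN QD : Set Q) (dD : Q → σ → Q) (w : ℕ → σ)
    (v : Option Q) (ℓ : ℕ) : Prop :=
  match v with
  | some q => q ∈ ldP A QN QD dD w ℓ
  | none => (ldS A QN w ℓ).Nonempty

/-- The edges of the LDBW run DAG `Ĝ`, from a vertex at level `ℓ` to one at level
`ℓ+1`. -/
def ldEdge (A : NBW σ Q) [LinearOrder Q] (QN QD : Set Q) (dD : Q → σ → Q)
    (w : ℕ → σ) (u : Option Q) (ℓ : ℕ) (v : Option Q) : Prop :=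
  match u, v with
  | none, none => (ldS A QN w ℓ).Nonempty ∧ (ldS A QN w (ℓ + 1)).Nonempty
  | none, some j => (ldS A QN w ℓ).Nonempty ∧ j ∈ ldJ A QN QD dD w ℓ
  | some q, some d =>
      q ∈ ldP A QN QD dD w ℓ ∧ d = dD q (w ℓ) ∧
        (ldPr A QN QD dD w (ℓ + 1)).1 d = (ldPr A QN QD dD w ℓ).1 q
  | some _, none => False

/-- `γ` is an initial ω-branch of `Ĝ` (an ω-branch starting at level `0`). -/
def ldInitOmegaBranch (A : NBW σ Q) [LinearOrder Q] (QN QD : Set Q)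
    (dD : Q → σ → Q) (w : ℕ → σ) (γ : ℕ → Option Q) : Prop :=
  (∀ ℓ, ldVtx A QN QD dD w (γ ℓ) ℓ) ∧
    ∀ ℓ, ldEdge A QN QD dD w (γ ℓ) ℓ (γ (ℓ + 1))

/-- The branch `γ` of `Ĝ` is accepting: it contains infinitely many `F`-vertices. -/
def ldAcceptingBranch (A : NBW σ Q) (γ : ℕ → Option Q) : Prop :=
  ∀ n, ∃ m, n ≤ m ∧ ∃ q, γ m = some q ∧ q ∈ A.acc

/-- There is an ω-branch of `Ĝ` starting at the vertex `v` of level `ℓ`. -/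
def ldOmegaBranchFrom (A : NBW σ Q) [LinearOrder Q] (QN QD : Set Q)
    (dD : Q → σ → Q) (w : ℕ → σ) (v : Option Q) (ℓ : ℕ) : Prop :=
  ∃ γ : ℕ → Option Q, γ 0 = v ∧ (∀ i, ldVtx A QN QD dD w (γ i) (ℓ + i)) ∧
    ∀ i, ldEdge A QN QD dD w (γ i) (ℓ + i) (γ (i + 1))

end NBW

namespace NBW

section Helpers

variable {σ Q : Type}

theorem ncard_le_injOn [Fintype Q] [LinearOrder Q] (S : Set Q) {a b : Q} (ha : a ∈ S)
    (hb : b ∈ S) (h : {q ∈ S | q ≤ a}.ncard = {q ∈ S | q ≤ b}.ncard) : a = b := by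
  have key : ∀ x y : Q, y ∈ S → x < y → {q ∈ S | q ≤ x}.ncard < {q ∈ S | q ≤ y}.ncard := by
    intro x y hy hxy
    refine Set.ncard_lt_ncard ?_ (Set.toFinite _)
    refine ⟨fun z hz => ⟨hz.1, hz.2.trans hxy.le⟩, fun hsub => ?_⟩
    have h1 := hsub (show y ∈ {q ∈ S | q ≤ y} from ⟨hy, le_refl y⟩)
    exact absurd hxy (not_lt.mpr h1.2)
  rcases lt_trichotomy a b with hl | he | hl
  · have := key a b hb hl
    omega
  · exact he
  · have := key b a ha hl
    omega

theorem ncard_le_pos [Fintype Q] [LinearOrder Q] (S : Set Q) {a : Q} (ha : a ∈ S) :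
    0 < {q ∈ S | q ≤ a}.ncard :=
  (Set.ncard_pos (Set.toFinite _)).mpr ⟨a, ha, le_refl a⟩

theorem ncard_le_le [Fintype Q] [LinearOrder Q] (S : Set Q) (a : Q) :
    {q ∈ S | q ≤ a}.ncard ≤ S.ncard :=
  Set.ncard_le_ncard (fun _ h => h.1) (Set.toFinite _)

theorem ldP_succ (A : NBW σ Q) (QN QD : Set Q) (dD : Q → σ → Q) (w : ℕ → σ) (ℓ : ℕ) :
    A.ldP QN QD dD w (ℓ + 1) = A.ldD QN QD dD w ℓ ∪ A.ldJ QN QD dD w ℓ := rfl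

theorem ldPr_succ_D (A : NBW σ Q) [LinearOrder Q] (QN QD : Set Q) (dD : Q → σ → Q)
    (w : ℕ → σ) (ℓ : ℕ) (d : Q) (hd : d ∈ A.ldD QN QD dD w ℓ) :
    ∃ q ∈ A.ldP QN QD dD w ℓ, dD q (w ℓ) = d ∧
      (A.ldPr QN QD dD w (ℓ + 1)).1 d = (A.ldPr QN QD dD w ℓ).1 q := by
  have hne : ((A.ldPr QN QD dD w ℓ).1 '' {q' ∈ A.ldP QN QD dD w ℓ | dD q' (w ℓ) = d}).Nonempty := by
    obtain ⟨q, hq, hqd⟩ := hd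
    exact ⟨_, q, ⟨hq, hqd⟩, rfl⟩
  obtain ⟨q, ⟨hq, hqd⟩, he⟩ := Nat.sInf_mem hne
  refine ⟨q, hq, hqd, ?_⟩
  rw [he]
  simp only [ldPr, if_pos hd]

theorem ldPr_succ_J (A : NBW σ Q) [LinearOrder Q] (QN QD : Set Q) (dD : Q → σ → Q)
    (w : ℕ → σ) (ℓ : ℕ) (d : Q) (hd : d ∈ A.ldJ QN QD dD w ℓ) :
    (A.ldPr QN QD dD w (ℓ + 1)).1 d =
      (A.ldPr QN QD dD w ℓ).2 + {j ∈ A.ldJ QN QD dD w ℓ | j ≤ d}.ncard - 1 := by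
  simp only [ldPr, if_neg hd.2]

theorem ldPr_succ_S (A : NBW σ Q) [LinearOrder Q] (QN QD : Set Q) (dD : Q → σ → Q)
    (w : ℕ → σ) (ℓ : ℕ) : (A.ldPr QN QD dD w (ℓ + 1)).2 =
      (A.ldPr QN QD dD w ℓ).2 + (A.ldJ QN QD dD w ℓ).ncard := by
  simp only [ldPr]

theorem ldPr_succ_le (A : NBW σ Q) [LinearOrder Q] (QN QD : Set Q) (dD : Q → σ → Q)
    (w : ℕ → σ) (ℓ : ℕ) (q : Q) (hq : q ∈ A.ldP QN QD dD w ℓ) :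
    (A.ldPr QN QD dD w (ℓ + 1)).1 (dD q (w ℓ)) ≤ (A.ldPr QN QD dD w ℓ).1 q := by
  have hd : dD q (w ℓ) ∈ A.ldD QN QD dD w ℓ := ⟨q, hq, rfl⟩
  simp only [ldPr, if_pos hd]
  exact Nat.sInf_le ⟨q, ⟨hq, rfl⟩, rfl⟩

theorem ldPr_inj (A : NBW σ Q) [Fintype Q] [LinearOrder Q] (QN QD : Set Q) (dD : Q → σ → Q)
    (w : ℕ → σ) (ℓ : ℕ) :
    (∀ q ∈ A.ldP QN QD dD w ℓ, (A.ldPr QN QD dD w ℓ).1 q < (A.ldPr QN QD dD w ℓ).2) ∧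
    (∀ q ∈ A.ldP QN QD dD w ℓ, ∀ q' ∈ A.ldP QN QD dD w ℓ,
      (A.ldPr QN QD dD w ℓ).1 q = (A.ldPr QN QD dD w ℓ).1 q' → q = q') := by
  induction ℓ with
  | zero =>
    constructor
    · intro q _
      exact Nat.lt_succ_of_le (ncard_le_le (A.init ∩ QD) q)
    · intro q hq q' hq' h
      exact ncard_le_injOn (A.init ∩ QD) hq hq' h
  | succ ℓ ih =>
    obtain ⟨ih1, ih2⟩ := ih
    have hS := ldPr_succ_S A QN QD dD w ℓ
    have hDJ : ∀ d ∈ A.ldD QN QD dD w ℓ,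
        (A.ldPr QN QD dD w (ℓ + 1)).1 d < (A.ldPr QN QD dD w ℓ).2 := by
      intro d hd
      obtain ⟨q, hq, _, he⟩ := ldPr_succ_D A QN QD dD w ℓ d hd
      rw [he]
      exact ih1 q hq
    constructor
    · intro d hd
      rw [ldP_succ] at hd
      rcases hd with hd | hd
      · have := hDJ d hd
        omega
      · have h1 := ldPr_succ_J A QN QD dD w ℓ d hd
        have h2 := ncard_le_pos _ hd
        have h3 := ncard_le_le (A.ldJ QN QD dD w ℓ) d
        omega
    · intro d hd d' hd' h
      rw [ldP_succ] at hd hd'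
      rcases hd with hd | hd <;> rcases hd' with hd' | hd'
      · obtain ⟨q, hq, hqd, he⟩ := ldPr_succ_D A QN QD dD w ℓ d hd
        obtain ⟨q', hq', hqd', he'⟩ := ldPr_succ_D A QN QD dD w ℓ d' hd'
        have := ih2 q hq q' hq' (by omega)
        rw [← hqd, ← hqd', this]
      · have h0 := hDJ d hd
        have h1 := ldPr_succ_J A QN QD dD w ℓ d' hd'
        have h2 := ncard_le_pos _ hd'
        omega
      · have h0 := hDJ d' hd'
        have h1 := ldPr_succ_J A QN QD dD w ℓ d hd
        have h2 := ncard_le_pos _ hd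
        omega
      · have h1 := ldPr_succ_J A QN QD dD w ℓ d hd
        have h2 := ncard_le_pos _ hd
        have h1' := ldPr_succ_J A QN QD dD w ℓ d' hd'
        have h2' := ncard_le_pos _ hd'
        exact ncard_le_injOn _ hd hd' (by omega)

/-- The infinite deterministic vertices of a level. -/
def ldInf (A : NBW σ Q) [LinearOrder Q] (QN QD : Set Q) (dD : Q → σ → Q) (w : ℕ → σ)
    (ℓ : ℕ) : Set Q :=
  {q | q ∈ A.ldP QN QD dD w ℓ ∧ A.ldOmegaBranchFrom QN QD dD w (some q) ℓ}

theorem ldInf_step (A : NBW σ Q) [LinearOrder Q] (QN QD : Set Q) (dD : Q → σ → Q)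
    (w : ℕ → σ) (ℓ : ℕ) (q : Q) (hq : q ∈ A.ldInf QN QD dD w ℓ) :
    dD q (w ℓ) ∈ A.ldInf QN QD dD w (ℓ + 1) ∧
      (A.ldPr QN QD dD w (ℓ + 1)).1 (dD q (w ℓ)) = (A.ldPr QN QD dD w ℓ).1 q := by
  obtain ⟨hP, γ, h0, hv, he⟩ := hq
  have e0 := he 0
  rw [h0] at e0
  rcases h1 : γ 1 with _ | d
  · rw [zero_add, h1] at e0
    exact e0.elim
  · rw [zero_add, h1] at e0
    obtain ⟨_, hd, hp⟩ := e0
    rw [add_zero] at hd hp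
    subst hd
    refine ⟨⟨Or.inl ⟨q, hP, rfl⟩, fun i => γ (i + 1), h1, fun i => ?_, fun i => ?_⟩, hp⟩
    · have := hv (i + 1)
      rwa [show ℓ + (i + 1) = ℓ + 1 + i by omega] at this
    · have := he (i + 1)
      rwa [show ℓ + (i + 1) = ℓ + 1 + i by omega] at this

theorem ldInf_injOn (A : NBW σ Q) [Fintype Q] [LinearOrder Q] (QN QD : Set Q) (dD : Q → σ → Q)
    (w : ℕ → σ) (ℓ : ℕ) :
    Set.InjOn (fun q => dD q (w ℓ)) (A.ldInf QN QD dD w ℓ) := by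
  intro a ha b hb hab
  have h1 := (ldInf_step A QN QD dD w ℓ a ha).2
  have h2 := (ldInf_step A QN QD dD w ℓ b hb).2
  simp only at hab
  rw [hab] at h1
  exact (ldPr_inj A QN QD dD w ℓ).2 a ha.1 b hb.1 (h1.symm.trans h2)

theorem ldInf_image_sub (A : NBW σ Q) [LinearOrder Q] (QN QD : Set Q) (dD : Q → σ → Q)
    (w : ℕ → σ) (ℓ : ℕ) :
    (fun q => dD q (w ℓ)) '' (A.ldInf QN QD dD w ℓ) ⊆ A.ldInf QN QD dD w (ℓ + 1) := by
  rintro _ ⟨q, hq, rfl⟩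
  exact (ldInf_step A QN QD dD w ℓ q hq).1

/-- From some level on, infinite vertices all come from infinite vertices. -/
theorem ldInf_stab (A : NBW σ Q) [Fintype Q] [LinearOrder Q] (QN QD : Set Q) (dD : Q → σ → Q)
    (w : ℕ → σ) : ∃ L, ∀ ℓ, L ≤ ℓ →
      A.ldInf QN QD dD w (ℓ + 1) = (fun q => dD q (w ℓ)) '' (A.ldInf QN QD dD w ℓ) := by
  have hstep : ∀ ℓ, (A.ldInf QN QD dD w ℓ).ncard ≤ (A.ldInf QN QD dD w (ℓ + 1)).ncard := by
    intro ℓ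
    rw [← (ldInf_injOn A QN QD dD w ℓ).ncard_image]
    exact Set.ncard_le_ncard (ldInf_image_sub A QN QD dD w ℓ) (Set.toFinite _)
  have hmono : Monotone (fun ℓ => (A.ldInf QN QD dD w ℓ).ncard) := monotone_nat_of_le_succ hstep
  have hb : BddAbove (Set.range (fun ℓ => (A.ldInf QN QD dD w ℓ).ncard)) := by
    refine ⟨(Set.univ : Set Q).ncard, ?_⟩
    rintro _ ⟨ℓ, rfl⟩
    exact Set.ncard_le_ncard (Set.subset_univ _) (Set.toFinite _)
  obtain ⟨L, hL⟩ := Nat.sSup_mem (Set.range_nonempty _) hb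
  refine ⟨L, fun ℓ hℓ => ?_⟩
  refine (Set.eq_of_subset_of_ncard_le (ldInf_image_sub A QN QD dD w ℓ) ?_ (Set.toFinite _)).symm
  rw [(ldInf_injOn A QN QD dD w ℓ).ncard_image]
  have h1 : (A.ldInf QN QD dD w (ℓ + 1)).ncard ≤ _ := le_csSup hb ⟨ℓ + 1, rfl⟩
  have h2 := hmono hℓ
  simp only at hL h2
  omega

/-- The deterministic orbit. -/
def ldOrb (dD : Q → σ → Q) (w : ℕ → σ) (L : ℕ) (q : Q) : ℕ → Q
  | 0 => q
  | k + 1 => dD (ldOrb dD w L q k) (w (L + k))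

theorem ldP_sub (A : NBW σ Q) (QN QD : Set Q) (dD : Q → σ → Q) (w : ℕ → σ)
    (hld : A.LimitDetPart QN QD) (hdD : ∀ q ∈ QD, ∀ a, A.trans q a = {dD q a}) (ℓ : ℕ) :
    A.ldP QN QD dD w ℓ ⊆ QD := by
  induction ℓ with
  | zero => exact fun q hq => hq.2
  | succ ℓ ih =>
    rintro q (⟨r, hr, rfl⟩ | hq)
    · obtain ⟨q', hq', he⟩ := hld.2.2.2 r (ih hr) (w ℓ)
      rw [hdD r (ih hr)] at he
      have : dD r (w ℓ) = q' := by simpa using he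
      simpa [this] using hq'
    · exact hq.1.2

/-- Every vertex state is reachable by a finite run. -/
theorem ld_reach (A : NBW σ Q) (QN QD : Set Q) (dD : Q → σ → Q) (w : ℕ → σ)
    (hld : A.LimitDetPart QN QD) (hdD : ∀ q ∈ QD, ∀ a, A.trans q a = {dD q a}) (ℓ : ℕ) :
    ∀ q, q ∈ A.ldS QN w ℓ ∨ q ∈ A.ldP QN QD dD w ℓ →
      ∃ ρ : ℕ → Q, ρ 0 ∈ A.init ∧ (∀ i < ℓ, ρ (i + 1) ∈ A.trans (ρ i) (w i)) ∧ ρ ℓ = q := by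
  induction ℓ with
  | zero =>
    intro q hq
    refine ⟨fun _ => q, ?_, by simp, rfl⟩
    rcases hq with hq | hq
    · exact hq.1
    · exact hq.1
  | succ ℓ ih =>
    intro q hq
    have : ∃ r, (r ∈ A.ldS QN w ℓ ∨ r ∈ A.ldP QN QD dD w ℓ) ∧ q ∈ A.trans r (w ℓ) := by
      rcases hq with hq | (⟨r, hr, rfl⟩ | hq)
      · have := hq.1
        simp only [Set.mem_iUnion] at this
        obtain ⟨r, hr, h⟩ := this
        exact ⟨r, Or.inl hr, h⟩
      · refine ⟨r, Or.inr hr, ?_⟩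
        rw [hdD r (ldP_sub A QN QD dD w hld hdD ℓ hr)]
        rfl
      · have := hq.1.1
        simp only [Set.mem_iUnion] at this
        obtain ⟨r, hr, h⟩ := this
        exact ⟨r, Or.inl hr, h⟩
    obtain ⟨r, hr, hrq⟩ := this
    obtain ⟨ρ, h0, h1, h2⟩ := ih r hr
    refine ⟨fun i => if i ≤ ℓ then ρ i else q, by simpa using h0, ?_, by simp⟩
    intro i hi
    rcases Nat.lt_or_ge i ℓ with h | h
    · simp only [if_pos (show i ≤ ℓ by omega), if_pos (show i + 1 ≤ ℓ by omega)]
      exact h1 i h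
    · have : i = ℓ := by omega
      subst this
      simp only [le_refl, if_true, if_neg (show ¬ i + 1 ≤ i by omega)]
      rw [h2]
      exact hrq

theorem ldOrb_mem (A : NBW σ Q) (QN QD : Set Q) (dD : Q → σ → Q) (w : ℕ → σ)
    (L : ℕ) (q : Q) (hq : q ∈ A.ldP QN QD dD w L) (k : ℕ) :
    ldOrb dD w L q k ∈ A.ldP QN QD dD w (L + k) := by
  induction k with
  | zero => exact hq
  | succ k ih => exact Or.inl ⟨_, ih, rfl⟩

theorem ldOrb_acc (A : NBW σ Q) (QN QD : Set Q) (dD : Q → σ → Q) (w : ℕ → σ)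
    (hld : A.LimitDetPart QN QD) (hdD : ∀ q ∈ QD, ∀ a, A.trans q a = {dD q a})
    (L : ℕ) (q : Q) (hq : q ∈ A.ldP QN QD dD w L)
    (hacc : ∀ n, ∃ m, n ≤ m ∧ ldOrb dD w L q m ∈ A.acc) : w ∈ A.Lang := by
  obtain ⟨ρ, h0, h1, h2⟩ := ld_reach A QN QD dD w hld hdD L q (Or.inr hq)
  refine ⟨fun i => if i ≤ L then ρ i else ldOrb dD w L q (i - L), ⟨by simpa using h0, ?_⟩, ?_⟩
  · intro i
    rcases Nat.lt_or_ge i L with h | h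
    · simp only [if_pos (show i ≤ L by omega), if_pos (show i + 1 ≤ L by omega)]
      exact h1 i h
    · obtain ⟨k, rfl⟩ := Nat.exists_eq_add_of_le h
      have e1 : (if L + k ≤ L then ρ (L + k) else ldOrb dD w L q (L + k - L))
          = ldOrb dD w L q k := by
        rcases Nat.eq_zero_or_pos k with hk | hk
        · subst hk
          simpa [ldOrb] using h2
        · rw [if_neg (by omega), Nat.add_sub_cancel_left]
      simp only [e1, if_neg (show ¬ L + k + 1 ≤ L by omega)]
      rw [show L + k + 1 - L = k + 1 by omega,
        hdD _ (ldP_sub A QN QD dD w hld hdD _ (ldOrb_mem A QN QD dD w L q hq k))]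
      rfl
  · intro n
    obtain ⟨m, hm, ha⟩ := hacc (n + 1)
    refine ⟨L + m, by omega, ?_⟩
    simp only [if_neg (show ¬ L + m ≤ L by omega), Nat.add_sub_cancel_left]
    exact ha

theorem ld_run_mem (A : NBW σ Q) (QN QD : Set Q) (dD : Q → σ → Q) (w : ℕ → σ)
    (hld : A.LimitDetPart QN QD) (hdD : ∀ q ∈ QD, ∀ a, A.trans q a = {dD q a})
    (ρ : ℕ → Q) (hρ : A.IsRun w ρ) (n : ℕ) :
    ρ n ∈ A.ldS QN w n ∨ ρ n ∈ A.ldP QN QD dD w n := by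
  have hcov : ∀ q, q ∈ QN ∨ q ∈ QD := fun q => by
    have : q ∈ QN ∪ QD := by rw [hld.2.1]; trivial
    exact this
  induction n with
  | zero =>
    rcases hcov (ρ 0) with h | h
    · exact Or.inl ⟨hρ.1, h⟩
    · exact Or.inr ⟨hρ.1, h⟩
  | succ n ih =>
    have ht := hρ.2 n
    rcases ih with ih | ih
    · have hu : ρ (n + 1) ∈ ⋃ q ∈ A.ldS QN w n, A.trans q (w n) := by
        simp only [Set.mem_iUnion]
        exact ⟨_, ih, ht⟩
      rcases hcov (ρ (n + 1)) with h | h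
      · exact Or.inl ⟨hu, h⟩
      · right
        rw [ldP_succ]
        by_cases hd : ρ (n + 1) ∈ A.ldD QN QD dD w n
        · exact Or.inl hd
        · exact Or.inr ⟨⟨hu, h⟩, hd⟩
    · rw [hdD _ (ldP_sub A QN QD dD w hld hdD _ ih)] at ht
      exact Or.inr (Or.inl ⟨_, ih, ht.symm⟩)

theorem ldS_sub (A : NBW σ Q) (QN : Set Q) (w : ℕ → σ) (ℓ : ℕ) : A.ldS QN w ℓ ⊆ QN := by
  cases ℓ with
  | zero => exact fun q hq => hq.2
  | succ ℓ => exact fun q hq => hq.2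

end Helpers

end NBW

/-- `w ∉ L(A)` iff the LDBW run DAG `Ĝ` has a stable level: some `s ≥ 1`
such that every `F`-vertex at a level `≥ s` is finite. -/
theorem NBW.ldbw_dag_stable_level (σ Q : Type) [Fintype σ] [Nonempty σ] [Fintype Q]
    [LinearOrder Q] (A : NBW σ Q) (QN QD : Set Q) (dD : Q → σ → Q)
    (hc : A.Complete) (hld : A.LimitDetPart QN QD)
    (hdD : ∀ q ∈ QD, ∀ a, A.trans q a = {dD q a})
    (hord : ∀ d ∈ QD, ∀ q ∈ QN, d ≤ q)
    (w : ℕ → σ) :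
    w ∉ A.Lang ↔
      ∃ s : ℕ, 1 ≤ s ∧ ∀ ℓ, s ≤ ℓ → ∀ q ∈ A.ldP QN QD dD w ℓ, q ∈ A.acc →
        ¬ A.ldOmegaBranchFrom QN QD dD w (some q) ℓ := by
  constructor
  · intro hw
    obtain ⟨L, hL⟩ := ldInf_stab A QN QD dD w
    have horb : ∀ k, ∀ q ∈ A.ldInf QN QD dD w (L + k),
        ∃ r ∈ A.ldInf QN QD dD w L, ldOrb dD w L r k = q := by
      intro k
      induction k with
      | zero => exact fun q hq => ⟨q, hq, rfl⟩
      | succ k ih =>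
        intro q hq
        rw [← add_assoc, hL (L + k) (by omega)] at hq
        obtain ⟨p, hp, rfl⟩ := hq
        obtain ⟨r, hr, rfl⟩ := ih p hp
        exact ⟨r, hr, rfl⟩
    have hfin : ∀ r, ∃ n, r ∈ A.ldInf QN QD dD w L →
        ∀ m, n ≤ m → ldOrb dD w L r m ∉ A.acc := by
      intro r
      by_cases hr : r ∈ A.ldInf QN QD dD w L
      · by_contra hcon
        refine hw (ldOrb_acc A QN QD dD w hld hdD L r hr.1 fun n => ?_)
        by_contra h2
        exact hcon ⟨n, fun _ m hm ha => h2 ⟨m, hm, ha⟩⟩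
      · exact ⟨0, fun h => absurd h hr⟩
    choose N hN using hfin
    refine ⟨L + Finset.univ.sup N + 1, by omega, ?_⟩
    intro ℓ hℓ q hq ha hbr
    obtain ⟨k, rfl⟩ := Nat.exists_eq_add_of_le (show L ≤ ℓ by omega)
    obtain ⟨r, hr, rfl⟩ := horb k q ⟨hq, hbr⟩
    have := Finset.le_sup (f := N) (Finset.mem_univ r)
    exact hN r hr k (by omega) ha
  · rintro ⟨s, _, hs⟩ ⟨ρ, hρ, hacc⟩
    have hmem := ld_run_mem A QN QD dD w hld hdD ρ hρ
    obtain ⟨m, _, hm⟩ := hacc 0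
    have hPm : ∀ n, ρ n ∈ A.acc → ρ n ∈ A.ldP QN QD dD w n := by
      intro n hn
      rcases hmem n with h | h
      · exact (Set.disjoint_left.mp hld.1 (ldS_sub A QN w n h) (hld.2.2.1 hn)).elim
      · exact h
    have hstep : ∀ n, ρ n ∈ A.ldP QN QD dD w n → ρ (n + 1) = dD (ρ n) (w n) := by
      intro n hn
      have ht := hρ.2 n
      rw [hdD _ (ldP_sub A QN QD dD w hld hdD _ hn)] at ht
      exact ht
    have hP : ∀ k, ρ (m + k) ∈ A.ldP QN QD dD w (m + k) := by
      intro k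
      induction k with
      | zero => exact hPm m hm
      | succ k ih => exact Or.inl ⟨_, ih, (hstep _ ih).symm⟩
    have hanti : Antitone fun k => (A.ldPr QN QD dD w (m + k)).1 (ρ (m + k)) := by
      refine antitone_nat_of_succ_le fun k => ?_
      have := ldPr_succ_le A QN QD dD w (m + k) _ (hP k)
      rw [← hstep _ (hP k)] at this
      exact this
    obtain ⟨K, hK⟩ := Nat.sInf_mem
      (Set.range_nonempty fun k => (A.ldPr QN QD dD w (m + k)).1 (ρ (m + k)))
    have hconst : ∀ k, K ≤ k → (A.ldPr QN QD dD w (m + k)).1 (ρ (m + k)) =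
        (A.ldPr QN QD dD w (m + K)).1 (ρ (m + K)) := by
      intro k hk
      refine le_antisymm (hanti hk) ?_
      simp only at hK
      rw [hK]
      exact Nat.sInf_le ⟨k, rfl⟩
    obtain ⟨n, hn, ha⟩ := hacc (s + m + K)
    refine hs n (by omega) (ρ n) (hPm n ha) ha ⟨fun i => some (ρ (n + i)), rfl, ?_, ?_⟩
    · intro i
      have := hP (n + i - m)
      rw [show m + (n + i - m) = n + i by omega] at this
      exact this
    · intro i
      have h1 := hP (n + i - m)
      have h2 := hconst (n + i - m) (by omega)
      have h3 := hconst (n + i + 1 - m) (by omega)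
      rw [show m + (n + i - m) = n + i by omega] at h1 h2
      rw [show m + (n + i + 1 - m) = n + i + 1 by omega] at h3
      exact ⟨h1, hstep _ h1, h3.trans h2.symm⟩
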